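/- Let 𝔥 be the Lie algebra on ℝ⁷ with structure equations de¹ = 0, de² = 0, de³ = −e³⁷, de⁴ = e⁴⁷, de⁵ = 2 e¹⁴ + e⁵⁷, de⁶ = −2 e²⁴ + e⁶⁷, de⁷ = 0, and let φ = e¹²⁷ + e³⁴⁷ + e⁵⁶⁷ + e¹³⁵ − e¹⁴⁶ − e²³⁶ − e²⁴⁵. Then dφ = 0 (φ is a closed 3-form for the Chevalley–Eilenberg differential), and for all u, v ∈ ℝ⁷ one has (1/6) ι_uφ ∧ ι_vφ ∧ φ = g_φ(u,v) e¹²³⁴⁵⁶⁷, where g_φ = Σ_{i=1}^{7} (e^i)² is the standard Euclidean inner product; in particular φ defines a closed G₂-structure on 𝔥 with induced metric g_φ and volume form dV_φ = e¹²³⁴⁵⁶⁷. -/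

import Mathlib

/-!
Common framework: unbundled exterior forms on ℝ⁷, wedge product, interior product,
Chevalley–Eilenberg differential of a Lie bracket, induced inner products on forms,
derived series, and the Lie algebras / G₂-structures from the paper
"Laplacian flow solitons on non-solvable Lie groups" (Fino–Raffero).
-/

open scoped BigOperators

namespace G2Solitons

/-- The underlying vector space ℝ⁷. -/
abbrev V7 : Type := Fin 7 → ℝ

/-- Unbundled `k`-forms: real-valued functions of `k` vectors of ℝ⁷. -/
abbrev Form (k : ℕ) : Type := (Fin k → V7) → ℝ

/-- Standard basis of ℝ⁷. -/
def stdB (i : Fin 7) : V7 := fun j => if j = i then 1 else 0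

/-- The basic `k`-form `e^{i₁} ∧ ⋯ ∧ e^{i_k}` (determinant convention, 0-indexed). -/
def eB {k : ℕ} (idx : Fin k → Fin 7) : Form k :=
  fun v => Matrix.det (Matrix.of fun a b : Fin k => v a (idx b))

/-- Wedge product of a `p`-form and a `q`-form (convention
`(α∧β)(v) = (p!q!)⁻¹ ∑_σ sgn σ · α(v∘σ|_{first p}) β(v∘σ|_{last q})`). -/
noncomputable def wedge {p q : ℕ} (α : Form p) (β : Form q) : Form (p + q) := fun v =>
  ((p.factorial * q.factorial : ℕ) : ℝ)⁻¹ *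
    ∑ σ : Equiv.Perm (Fin (p + q)),
      ((Equiv.Perm.sign σ : ℤ) : ℝ) *
        (α (fun i => v (σ (Fin.castAdd q i))) * β (fun j => v (σ (Fin.natAdd p j))))

/-- Interior product of a vector with a `(k+1)`-form. -/
def iprod {k : ℕ} (u : V7) (α : Form (k + 1)) : Form k := fun v => α (Fin.cons u v)

/-- Chevalley–Eilenberg differential of a `(k+1)`-form with respect to a bracket:
`(dα)(x₀,…,x_{k+1}) = ∑_{i<j} (-1)^{i+j} α([xᵢ,xⱼ], x₀,…,x̂ᵢ,…,x̂ⱼ,…,x_{k+1})`. -/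
def dCE {k : ℕ} (br : V7 → V7 → V7) (α : Form (k + 1)) : Form (k + 2) := fun v =>
  ∑ i : Fin (k + 2), ∑ j : Fin (k + 2),
    if (i : ℕ) < (j : ℕ) then
      (-1 : ℝ) ^ ((i : ℕ) + (j : ℕ)) *
        α (Fin.cons (br (v i) (v j)) fun l : Fin k =>
            if (l : ℕ) < (i : ℕ) then v ⟨(l : ℕ), by omega⟩
            else if (l : ℕ) + 1 < (j : ℕ) then v ⟨(l : ℕ) + 1, by omega⟩
            else v ⟨(l : ℕ) + 2, by omega⟩)
    else 0

/-- Inner product on `k`-forms induced by the diagonal metric `g = ∑ᵢ c i (e^i)²`,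
determined by declaring `{(c i₁ ⋯ c i_k)^{-1/2} e^{i₁⋯i_k} : i₁ < ⋯ < i_k}` orthonormal. -/
noncomputable def formInner (c : Fin 7 → ℝ) {k : ℕ} (α β : Form k) : ℝ :=
  ((k.factorial : ℕ) : ℝ)⁻¹ *
    ∑ f : Fin k → Fin 7,
      (∏ i, c (f i))⁻¹ * (α (fun i => stdB (f i)) * β (fun i => stdB (f i)))

/-- Natural action of an endomorphism `D` on a `k`-form:
`(D.α)(v₁,…,v_k) = ∑ᵢ α(v₁,…,D vᵢ,…,v_k)`. -/
def actD {k : ℕ} (D : V7 → V7) (α : Form k) : Form k := fun v =>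
  ∑ i : Fin k, α (Function.update v i (D (v i)))

/-- The Jacobi identity for a bilinear bracket. -/
def Jacobi (br : V7 → V7 → V7) : Prop :=
  ∀ x y z : V7, br (br x y) z + br (br y z) x + br (br z x) y = 0

/-- Unimodularity: `tr (ad x) = 0` for all `x`. -/
def Unimodular (br : V7 → V7 → V7) : Prop :=
  ∀ x : V7, ∑ i : Fin 7, br x (stdB i) i = 0

/-- Derivation property for a map `D`. -/
def IsDeriv (br : V7 → V7 → V7) (D : V7 → V7) : Prop :=
  ∀ x y : V7, D (br x y) = br (D x) y + br x (D y)

/-- Derived series of a bracket. -/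
def derSeries (br : V7 → V7 → V7) : ℕ → Submodule ℝ V7
  | 0 => ⊤
  | n + 1 => Submodule.span ℝ
      {z | ∃ x ∈ derSeries br n, ∃ y ∈ derSeries br n, z = br x y}

/-- Solvability: the derived series terminates at zero. -/
def Solvable (br : V7 → V7 → V7) : Prop := ∃ n, derSeries br n = ⊥

/-- Real cube root (the real root, also for negative arguments). -/
noncomputable def cbrt (x : ℝ) : ℝ :=
  if x < 0 then -((-x) ^ ((1 : ℝ) / 3)) else x ^ ((1 : ℝ) / 3)

/-- The standard volume form `e^{1234567}`. -/
def vol7 : Form 7 := eB ![0, 1, 2, 3, 4, 5, 6]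

end G2Solitons

namespace G2Solitons

noncomputable section

/-- The bracket of the Lie algebra `𝔥` with structure equations
`(0, 0, -e³⁷, e⁴⁷, 2 e¹⁴ + e⁵⁷, -2 e²⁴ + e⁶⁷, 0)`,
via the convention `dα(x,y) = -α([x,y])`. -/
def brH : V7 → V7 → V7 := fun x y =>
  ![0,
    0,
    x 2 * y 6 - x 6 * y 2,
    -(x 3 * y 6 - x 6 * y 3),
    -2 * (x 0 * y 3 - x 3 * y 0) - (x 4 * y 6 - x 6 * y 4),
    2 * (x 1 * y 3 - x 3 * y 1) - (x 5 * y 6 - x 6 * y 5),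
    0]

/-- `φ = e¹²⁷ + e³⁴⁷ + e⁵⁶⁷ + e¹³⁵ - e¹⁴⁶ - e²³⁶ - e²⁴⁵`. -/
def phiH : Form 3 := fun v =>
  eB ![0, 1, 6] v + eB ![2, 3, 6] v + eB ![4, 5, 6] v
    + eB ![0, 2, 4] v - eB ![0, 3, 5] v - eB ![1, 2, 5] v - eB ![1, 3, 4] v

/-- The standard Euclidean metric `g_φ = ∑_{i=1}^{7} (e^i)²`. -/
def gH (u v : V7) : ℝ := ∑ i : Fin 7, u i * v i

/-- `τ = 2 e¹² + 2 e³⁴ - 4 e⁵⁶`. -/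
def tauH : Form 2 := fun v =>
  2 * eB ![0, 1] v + 2 * eB ![2, 3] v - 4 * eB ![4, 5] v

/-- `D = diag(0, 0, -4, 4, 4, 4, 0)`. -/
def DH : V7 → V7 := fun x i => (![0, 0, -4, 4, 4, 4, 0] : Fin 7 → ℝ) i * x i

end

end G2Solitons

namespace G2Solitons

theorem wedge_eB {p q : ℕ} (I : Fin p → Fin 7) (J : Fin q → Fin 7) :
    wedge (eB I) (eB J) = eB (Fin.append I J) := by
  funext v
  have key : ∀ (τ : Equiv.Perm (Fin p)) (ρ : Equiv.Perm (Fin q)),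
      ∑ σ : Equiv.Perm (Fin (p + q)), ((Equiv.Perm.sign σ : ℤ) : ℝ) *
        ((((Equiv.Perm.sign τ : ℤ) : ℝ) * ∏ i, v (σ (Fin.castAdd q (τ i))) (I i)) *
          (((Equiv.Perm.sign ρ : ℤ) : ℝ) * ∏ j, v (σ (Fin.natAdd p (ρ j))) (J j)))
        = eB (Fin.append I J) v := by
    intro τ ρ
    set π : Equiv.Perm (Fin (p + q)) :=
      finSumFinEquiv.permCongr (Equiv.Perm.sumCongr τ ρ) with hπ
    have hsign : Equiv.Perm.sign π = Equiv.Perm.sign τ * Equiv.Perm.sign ρ := by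
      rw [hπ, Equiv.Perm.sign_permCongr, Equiv.Perm.sign_sumCongr]
    unfold eB
    rw [Matrix.det_apply']
    refine Fintype.sum_equiv (Equiv.mulRight π) _ _ fun σ => ?_
    simp only [Equiv.coe_mulRight, Equiv.Perm.sign_mul, hsign, Fin.prod_univ_add,
      Matrix.of_apply, Fin.append_left, Fin.append_right, Equiv.Perm.coe_mul,
      Function.comp_apply]
    simp only [hπ, Equiv.permCongr_apply, finSumFinEquiv_symm_apply_castAdd,
      finSumFinEquiv_symm_apply_natAdd, Equiv.Perm.sumCongr_apply, Sum.map_inl, Sum.map_inr,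
      finSumFinEquiv_apply_left, finSumFinEquiv_apply_right]
    push_cast
    ring
  have expand : ∑ σ : Equiv.Perm (Fin (p + q)), ((Equiv.Perm.sign σ : ℤ) : ℝ) *
        (eB I (fun i => v (σ (Fin.castAdd q i))) * eB J (fun j => v (σ (Fin.natAdd p j))))
      = ∑ τ : Equiv.Perm (Fin p), ∑ ρ : Equiv.Perm (Fin q), eB (Fin.append I J) v := by
    rw [← Finset.sum_congr rfl fun τ _ => Finset.sum_congr rfl fun ρ _ => key τ ρ]
    simp only [eB, Matrix.det_apply', Matrix.of_apply, Finset.sum_mul_sum]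
    simp only [Finset.mul_sum]
    rw [Finset.sum_comm]
    exact Finset.sum_congr rfl fun τ _ => Finset.sum_comm
  unfold wedge
  rw [expand]
  simp only [Finset.sum_const, Finset.card_univ, Fintype.card_perm, Fintype.card_fin,
    nsmul_eq_mul]
  have hp : (p.factorial : ℝ) ≠ 0 := by exact_mod_cast p.factorial_ne_zero
  have hq : (q.factorial : ℝ) ≠ 0 := by exact_mod_cast q.factorial_ne_zero
  push_cast
  field_simp

theorem wedge_sum_left {ι : Type*} (s : Finset ι) {p q : ℕ} (c : ι → ℝ) (α : ι → Form p)
    (β : Form q) :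
    wedge (fun v => ∑ i ∈ s, c i * α i v) β = fun v => ∑ i ∈ s, c i * wedge (α i) β v := by
  funext v
  simp only [wedge, Finset.mul_sum, Finset.sum_mul]
  rw [Finset.sum_comm]
  exact Finset.sum_congr rfl fun i _ => Finset.sum_congr rfl fun σ _ => by ring

theorem wedge_sum_right {ι : Type*} (s : Finset ι) {p q : ℕ} (c : ι → ℝ) (α : Form p)
    (β : ι → Form q) :
    wedge α (fun v => ∑ i ∈ s, c i * β i v) = fun v => ∑ i ∈ s, c i * wedge α (β i) v := by
  funext v
  simp only [wedge, Finset.mul_sum]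
  rw [Finset.sum_comm]
  exact Finset.sum_congr rfl fun i _ => Finset.sum_congr rfl fun σ _ => by ring

/-- The sign of `b - a`. -/
def compareSign (a b : ℕ) : ℤ := if a < b then 1 else if a = b then 0 else -1

/-- The Levi-Civita symbol on seven indices, as a product over pairs of positions. -/
def leviCivita (J : Fin 7 → Fin 7) : ℤ :=
  ∏ j, ∏ i ∈ Finset.Iio j, compareSign (J i) (J j)

theorem eB_eq_leviCivita_mul_vol7 (J : Fin 7 → Fin 7) (w : Fin 7 → V7) :
    eB J w = (leviCivita J : ℝ) * vol7 w := by
  have hid : (![0, 1, 2, 3, 4, 5, 6] : Fin 7 → Fin 7) = id := by decide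
  by_cases hJ : Function.Injective J
  · let σ : Equiv.Perm (Fin 7) := Equiv.ofBijective J (Finite.injective_iff_bijective.mp hJ)
    have hsign : leviCivita J = (Equiv.Perm.sign σ : ℤ) := by
      rw [Equiv.Perm.sign_eq_prod_prod_Iio, leviCivita]
      push_cast
      refine Finset.prod_congr rfl fun j _ => Finset.prod_congr rfl fun i hi => ?_
      have hij : J i ≠ J j := fun h => (Finset.mem_Iio.mp hi).ne (hJ h)
      change _ = (((if J i < J j then 1 else -1 : ℤˣ)) : ℤ)
      simp only [compareSign, Fin.val_fin_lt, Fin.val_inj, hij, if_false]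
      split_ifs <;> rfl
    rw [hsign, vol7, hid]
    exact Matrix.det_permute' σ (Matrix.of fun a b : Fin 7 => w a b)
  · have hzero : leviCivita J = 0 := by
      obtain ⟨i, j, hij, hlt⟩ : ∃ i j, J i = J j ∧ i < j := by
        simp only [Function.Injective, not_forall] at hJ
        obtain ⟨i, j, h, hne⟩ := hJ
        rcases lt_or_gt_of_ne hne with hlt | hlt
        · exact ⟨i, j, h, hlt⟩
        · exact ⟨j, i, h.symm, hlt⟩
      exact Finset.prod_eq_zero (Finset.mem_univ j)
        (Finset.prod_eq_zero (Finset.mem_Iio.mpr hlt) (by simp [hij, compareSign]))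
    simp only [Function.Injective, not_forall] at hJ
    obtain ⟨i, j, h, hne⟩ := hJ
    rw [hzero, Int.cast_zero, zero_mul]
    exact Matrix.det_zero_of_column_eq hne fun a => by simp [h]

/-- Index triples, oriented so that `phiH` is the sum of the corresponding basic forms. -/
def phiTriple : Fin 7 → Fin 3 → Fin 7 :=
  ![![0, 1, 6], ![2, 3, 6], ![4, 5, 6], ![0, 2, 4], ![0, 5, 3], ![1, 5, 2], ![1, 4, 3]]

/-- Index pairs, oriented so that the contraction of `phiH` with the `p`-th basis vector is
the sum of the basic forms indexed by `contractionPair p`. -/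
def contractionPair : Fin 7 → Fin 3 → Fin 2 → Fin 7 :=
  ![![![1, 6], ![2, 4], ![5, 3]], ![![6, 0], ![5, 2], ![4, 3]],
    ![![3, 6], ![4, 0], ![1, 5]], ![![6, 2], ![0, 5], ![1, 4]],
    ![![5, 6], ![0, 2], ![3, 1]], ![![6, 4], ![3, 0], ![2, 1]],
    ![![0, 1], ![2, 3], ![4, 5]]]

theorem phiH_eq_sum : phiH = fun v => ∑ t, (1 : ℝ) * eB (phiTriple t) v := by
  funext v
  simp [phiH, phiTriple, eB, Fin.sum_univ_succ, Matrix.det_fin_three]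
  ring

theorem iprod_phiH_eq_sum (u : V7) :
    iprod u phiH =
      fun v => ∑ x : Fin 7 × Fin 3, u x.1 * eB (contractionPair x.1 x.2) v := by
  funext v
  simp only [Fintype.sum_prod_type]
  have h0 : (Fin.cons u v : Fin 3 → V7) 0 = u := rfl
  have h1 : (Fin.cons u v : Fin 3 → V7) 1 = v 0 := rfl
  have h2 : (Fin.cons u v : Fin 3 → V7) 2 = v 1 := rfl
  simp [iprod, phiH, contractionPair, eB, Fin.sum_univ_succ, Matrix.det_fin_three,
    Matrix.det_fin_two, h0, h1, h2]
  ring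

/-- The Levi-Civita symbol of seven numbers, written out so that the kernel evaluates it fast. -/
def orderSign (x0 x1 x2 x3 x4 x5 x6 : ℕ) : ℤ :=
    (compareSign x0 x1) *
    (compareSign x0 x2 * compareSign x1 x2) *
    (compareSign x0 x3 * compareSign x1 x3 * compareSign x2 x3) *
    (compareSign x0 x4 * compareSign x1 x4 * compareSign x2 x4 *
      compareSign x3 x4) *
    (compareSign x0 x5 * compareSign x1 x5 * compareSign x2 x5 *
      compareSign x3 x5 * compareSign x4 x5) *
    (compareSign x0 x6 * compareSign x1 x6 * compareSign x2 x6 *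
      compareSign x3 x6 * compareSign x4 x6 * compareSign x5 x6)

theorem leviCivita_append (P Q : Fin 2 → Fin 7) (T : Fin 3 → Fin 7) :
    leviCivita (Fin.append (Fin.append P Q) T) =
      orderSign (P 0) (P 1) (Q 0) (Q 1) (T 0) (T 1) (T 2) := by
  have hJ : (Fin.append (Fin.append P Q) T : Fin 7 → Fin 7) =
      ![P 0, P 1, Q 0, Q 1, T 0, T 1, T 2] := by
    funext i
    fin_cases i <;> rfl
  have hIio : ∀ (j : Fin 7) (f : Fin 7 → ℤ),
      ∏ i ∈ Finset.Iio j, f i = ∏ i, if i < j then f i else 1 := fun j f => by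
    rw [← Finset.prod_filter]
    congr 1
    ext i
    simp
  rw [hJ]
  simp [leviCivita, orderSign, hIio, Fin.prod_univ_seven, mul_assoc]

theorem sum_leviCivita : ∀ p q : Fin 7, ∑ k, ∑ l, ∑ t,
    leviCivita (Fin.append (Fin.append (contractionPair p k) (contractionPair q l))
      (phiTriple t)) = if p = q then 6 else 0 := by
  simp only [leviCivita_append]
  decide +kernel

theorem dCE_three_form (br : V7 → V7 → V7) (α : Form 3) (v : Fin 4 → V7) :
    dCE br α v =
      -α ![br (v 0) (v 1), v 2, v 3] + α ![br (v 0) (v 2), v 1, v 3]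
        - α ![br (v 0) (v 3), v 1, v 2] - α ![br (v 1) (v 2), v 0, v 3]
        + α ![br (v 1) (v 3), v 0, v 2] - α ![br (v 2) (v 3), v 0, v 1] := by
  have hvec : ∀ (x : V7) (f : Fin 2 → V7),
      (Fin.cons x f : Fin 3 → V7) = ![x, f 0, f 1] := fun x f => by
    funext i
    fin_cases i <;> rfl
  simp only [dCE, hvec]
  simp [Fin.sum_univ_four]
  ring

theorem dCE_phiH (v : Fin 4 → V7) : dCE brH phiH v = 0 := by
  rw [dCE_three_form]
  simp [brH, phiH, eB, Matrix.det_fin_three]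
  ring

theorem wedge_iprod_phiH (u v : V7) (w : Fin 7 → V7) :
    wedge (wedge (iprod u phiH) (iprod v phiH)) phiH w = 6 * (gH u v * vol7 w) := by
  have hterm : ∀ p q k l t, wedge (wedge (eB (contractionPair p k)) (eB (contractionPair q l)))
      (eB (phiTriple t)) w = (leviCivita (Fin.append (Fin.append (contractionPair p k)
        (contractionPair q l)) (phiTriple t)) : ℝ) * vol7 w := fun p q k l t => by
    rw [wedge_eB, wedge_eB]
    exact eB_eq_leviCivita_mul_vol7 _ w
  have hsum : ∀ p q, ∑ k, ∑ l, ∑ t, wedge (wedge (eB (contractionPair p k))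
      (eB (contractionPair q l))) (eB (phiTriple t)) w
        = (if p = q then 6 else 0) * vol7 w := fun p q => by
    simp_rw [hterm, ← Finset.sum_mul]
    congr 1
    exact_mod_cast sum_leviCivita p q
  rw [iprod_phiH_eq_sum u, wedge_sum_left, wedge_sum_left]
  simp only [iprod_phiH_eq_sum v, wedge_sum_right, wedge_sum_left]
  simp only [phiH_eq_sum, wedge_sum_right]
  simp only [one_mul, Fintype.sum_prod_type, ← Finset.mul_sum]
  have hinner : ∀ p, ∑ k, ∑ q, v q * ∑ l, ∑ t, wedge (wedge (eB (contractionPair p k))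
      (eB (contractionPair q l))) (eB (phiTriple t)) w = 6 * (v p * vol7 w) := fun p => by
    rw [Finset.sum_comm]
    simp_rw [← Finset.mul_sum, hsum]
    simp
    ring
  simp_rw [hinner, gH, Finset.sum_mul, Finset.mul_sum]
  exact Finset.sum_congr rfl fun p _ => by ring

theorem gH_self_pos (u : V7) (hu : u ≠ 0) : 0 < gH u u := by
  obtain ⟨i, hi⟩ := Function.ne_iff.mp hu
  exact Finset.sum_pos' (fun j _ => mul_self_nonneg (u j))
    ⟨i, Finset.mem_univ i, mul_self_pos.mpr hi⟩

/-- `φ` is closed, `(1/6) ι_uφ ∧ ι_vφ ∧ φ = g_φ(u,v) e¹²³⁴⁵⁶⁷` with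
`g_φ` the standard Euclidean inner product; so `φ` is a closed G₂-structure on `𝔥`. -/
theorem closed_G2_H :
    (∀ v, dCE brH phiH v = 0) ∧
    (∀ u v : V7, ∀ w : Fin 7 → V7,
      (1 / 6 : ℝ) * wedge (wedge (iprod u phiH) (iprod v phiH)) phiH w
        = gH u v * vol7 w) ∧
    ∀ u : V7, u ≠ 0 → 0 < gH u u := by
  refine ⟨dCE_phiH, fun u v w => ?_, gH_self_pos⟩
  rw [wedge_iprod_phiH]
  ring

end G2Solitons
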